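/- Suppose the rule set D includes the Assumption, Antecedent, Reflexivity of equality, and Substitution through equality rules, and Φ ⊆ F^S is D-expanded. Then for every atomic formula φ ∈ F^S_0, the Henkin interpretation I_{(Φ,D)} satisfies φ if and only if φ ∈ Φ. -/

import Mathlib

/-! Common development: first-order syntax with NOR and a single quantifier,
sequent rules, derivations, consistency, semantics. Variables are indexed by ℕ
(the countably infinite variable set X). -/

/-- The alphabet: symbols of `S`, variables, and the logical symbols `↓ ≡ ∃`. -/
inductive Alph (S : Type) : Type where
  | sym : S → Alph S
  | var : ℕ → Alph S
  | nor : Alph S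
  | eqs : Alph S
  | exs : Alph S

/-- Terms over a symbol set `S` with signed arity `ar`. -/
inductive Tm (S : Type) (ar : S → ℤ) : Type where
  | var : ℕ → Tm S ar
  | const : (s : S) → ar s = 0 → Tm S ar
  | func : (s : S) → 0 < ar s → (Fin (ar s).toNat → Tm S ar) → Tm S ar

/-- Formulas over `S`: equality, relational atoms, NOR, existential quantification. -/
inductive Fm (S : Type) (ar : S → ℤ) : Type where
  | eq : Tm S ar → Tm S ar → Fm S ar
  | rel : (s : S) → ar s < 0 → (Fin (-ar s).toNat → Tm S ar) → Fm S ar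
  | nor : Fm S ar → Fm S ar → Fm S ar
  | ex : ℕ → Fm S ar → Fm S ar

variable {S : Type} {ar : S → ℤ}

/-- `¬φ` abbreviates `↓φφ`. -/
def Fm.neg (φ : Fm S ar) : Fm S ar := Fm.nor φ φ

/-- Substitution of a term for a variable in a term. -/
def Tm.substT : Tm S ar → ℕ → Tm S ar → Tm S ar
  | Tm.var n, x, u => if n = x then u else Tm.var n
  | Tm.const s h, _, _ => Tm.const s h
  | Tm.func s h ts, x, u => Tm.func s h (fun i => (ts i).substT x u)

/-- Substitution `φ[u/x]` of a term for the free occurrences of a variable in a formula. -/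
def Fm.substF : Fm S ar → ℕ → Tm S ar → Fm S ar
  | Fm.eq t₁ t₂, x, u => Fm.eq (t₁.substT x u) (t₂.substT x u)
  | Fm.rel s h ts, x, u => Fm.rel s h (fun i => (ts i).substT x u)
  | Fm.nor φ ψ, x, u => Fm.nor (φ.substF x u) (ψ.substF x u)
  | Fm.ex y φ, x, u => if y = x then Fm.ex y φ else Fm.ex y (φ.substF x u)

/-- Variables occurring in a term. -/
def Tm.varsT : Tm S ar → Set ℕ
  | Tm.var n => {n}
  | Tm.const _ _ => ∅
  | Tm.func _ _ ts => ⋃ i, (ts i).varsT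

/-- Free variables of a formula. -/
def Fm.freeF : Fm S ar → Set ℕ
  | Fm.eq t₁ t₂ => t₁.varsT ∪ t₂.varsT
  | Fm.rel _ _ ts => ⋃ i, (ts i).varsT
  | Fm.nor φ ψ => φ.freeF ∪ ψ.freeF
  | Fm.ex y φ => φ.freeF \ {y}

/-- Free variables of a set of formulas. -/
def FreeSet (Φ : Set (Fm S ar)) : Set ℕ := ⋃ φ ∈ Φ, φ.freeF

/-- Atomic formulas: equalities and relational atoms. -/
def Fm.Atomic : Fm S ar → Prop
  | Fm.eq _ _ => True
  | Fm.rel _ _ _ => True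
  | _ => False

/-- The ten basic sequent rules. -/
inductive Rule : Type where
  | ass | ant | refl | subst | exS | exA | norI | norS | ctrP | ctrN
  deriving DecidableEq

noncomputable instance : DecidableEq (Fm S ar) := Classical.decEq _

/-- Derivability of a sequent `Γ φ` using only the rules in `D`. -/
inductive Der (D : Set Rule) : Finset (Fm S ar) → Fm S ar → Prop where
  | ass : Rule.ass ∈ D → ∀ {Γ : Finset (Fm S ar)} {φ : Fm S ar}, φ ∈ Γ → Der D Γ φ
  | ant : Rule.ant ∈ D → ∀ {Γ Γ' : Finset (Fm S ar)} {φ : Fm S ar},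
      Γ ⊆ Γ' → Der D Γ φ → Der D Γ' φ
  | refl : Rule.refl ∈ D → ∀ t : Tm S ar, Der D ∅ (Fm.eq t t)
  | subst : Rule.subst ∈ D → ∀ {Γ : Finset (Fm S ar)} (φ : Fm S ar) (x : ℕ) (t t' : Tm S ar),
      Der D Γ (φ.substF x t) → Der D (insert (Fm.eq t t') Γ) (φ.substF x t')
  | exS : Rule.exS ∈ D → ∀ {Γ : Finset (Fm S ar)} (φ : Fm S ar) (x : ℕ) (t : Tm S ar),
      Der D Γ (φ.substF x t) → Der D Γ (Fm.ex x φ)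
  | exA : Rule.exA ∈ D → ∀ {Γ : Finset (Fm S ar)} (φ ψ : Fm S ar) (x x' : ℕ),
      x' ∉ FreeSet ((↑Γ : Set (Fm S ar)) ∪ {Fm.ex x φ, ψ}) →
      Der D (insert (φ.substF x (Tm.var x')) Γ) ψ → Der D (insert (Fm.ex x φ) Γ) ψ
  | norI : Rule.norI ∈ D → ∀ {Γ : Finset (Fm S ar)} {φ₁ φ₂ : Fm S ar},
      Der D Γ (Fm.nor φ₁ φ₁) → Der D Γ (Fm.nor φ₂ φ₂) → Der D Γ (Fm.nor φ₁ φ₂)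
  | norS : Rule.norS ∈ D → ∀ {Γ : Finset (Fm S ar)} {φ₁ φ₂ : Fm S ar},
      Der D Γ (Fm.nor φ₁ φ₂) → Der D Γ (Fm.nor φ₂ φ₁)
  | ctrP : Rule.ctrP ∈ D → ∀ {Γ : Finset (Fm S ar)} {φ ψ : Fm S ar},
      Der D (insert φ Γ) ψ → Der D (insert φ Γ) ψ.neg → Der D Γ φ.neg
  | ctrN : Rule.ctrN ∈ D → ∀ {Γ : Finset (Fm S ar)} {φ ψ : Fm S ar},
      Der D (insert φ.neg Γ) ψ → Der D (insert φ.neg Γ) ψ.neg → Der D Γ φ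

/-- `Φ ⊢_D φ` : some sequent `Γ φ` with `Γ` a finite subset of `Φ` is derivable using rules of `D`. -/
def Derives (D : Set Rule) (Φ : Set (Fm S ar)) (φ : Fm S ar) : Prop :=
  ∃ Γ : Finset (Fm S ar), (↑Γ : Set (Fm S ar)) ⊆ Φ ∧ Der D Γ φ

/-- `Φ` is `D`-consistent. -/
def Consistent (D : Set Rule) (Φ : Set (Fm S ar)) : Prop :=
  ¬ ∃ φ : Fm S ar, Derives D Φ φ ∧ Derives D Φ φ.neg

/-- `Φ` is a covering: it contains `φ` or `¬φ` for every formula `φ`. -/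
def Covering (Φ : Set (Fm S ar)) : Prop := ∀ φ : Fm S ar, φ ∈ Φ ∨ φ.neg ∈ Φ

/-- `Φ` is a minimal covering: exactly one of `φ`, `¬φ` belongs to `Φ`. -/
def MinimalCovering (Φ : Set (Fm S ar)) : Prop :=
  ∀ φ : Fm S ar, (φ ∈ Φ ∧ φ.neg ∉ Φ) ∨ (φ ∉ Φ ∧ φ.neg ∈ Φ)

/-- `Φ` is `D`-expanded: everything derivable from `Φ` is already in `Φ`. -/
def Expanded (D : Set Rule) (Φ : Set (Fm S ar)) : Prop :=
  ∀ φ : Fm S ar, Derives D Φ φ → φ ∈ Φ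

/-- `Φ` is `D`-maximal: a `D`-consistent covering. -/
def DMaximal (D : Set Rule) (Φ : Set (Fm S ar)) : Prop := Consistent D Φ ∧ Covering Φ

/-- `Φ` is witness-furnished. -/
def WitnessFurnished (Φ : Set (Fm S ar)) : Prop :=
  ∀ (x : ℕ) (φ : Fm S ar), Fm.ex x φ ∈ Φ → ∃ t : Tm S ar, φ.substF x t ∈ Φ

/-- An interpretation of `S`: a universe, interpretations of the symbols of the
appropriate arities (function symbols of arity `n > 0` as `n`-ary operations,
constants as elements via nullary operations, relation symbols of arity `-n`
as `n`-ary relations), and an assignment of the variables. -/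
structure Interp (S : Type) (ar : S → ℤ) : Type 1 where
  A : Type
  ifun : (s : S) → (Fin (ar s).toNat → A) → A
  irel : (s : S) → (Fin (-ar s).toNat → A) → Prop
  asg : ℕ → A

/-- Evaluation of terms. -/
def Interp.evalT (I : Interp S ar) : Tm S ar → I.A
  | Tm.var n => I.asg n
  | Tm.const s h => I.ifun s (fun i => absurd i.2 (by omega))
  | Tm.func s _ ts => I.ifun s (fun i => I.evalT (ts i))

/-- Mutation of the assignment at one variable. -/
def Interp.updAsg (I : Interp S ar) (x : ℕ) (a : I.A) : Interp S ar :=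
  { I with asg := Function.update I.asg x a }

/-- Tarskian satisfaction. -/
def Interp.Sat : (I : Interp S ar) → Fm S ar → Prop
  | I, Fm.eq t₁ t₂ => I.evalT t₁ = I.evalT t₂
  | I, Fm.rel s _ ts => I.irel s (fun i => I.evalT (ts i))
  | I, Fm.nor φ ψ => ¬ Interp.Sat I φ ∧ ¬ Interp.Sat I ψ
  | I, Fm.ex x φ => ∃ a : I.A, Interp.Sat (I.updAsg x a) φ

/-- `Φ` is satisfiable: some interpretation makes every formula of `Φ` true. -/
def Satisfiable (Φ : Set (Fm S ar)) : Prop := ∃ I : Interp S ar, ∀ φ ∈ Φ, I.Sat φ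

/-- Semantic entailment `Φ ⊨ φ`. -/
def Entails (Φ : Set (Fm S ar)) (φ : Fm S ar) : Prop :=
  ∀ I : Interp S ar, (∀ ψ ∈ Φ, I.Sat ψ) → I.Sat φ
variable {S : Type} {ar : S → ℤ}

/-- Polish-notation string of a term, as a word over the alphabet. -/
def Tm.toStr : Tm S ar → List (Alph S)
  | Tm.var n => [Alph.var n]
  | Tm.const s _ => [Alph.sym s]
  | Tm.func s _ ts => Alph.sym s :: (List.ofFn (fun i => (ts i).toStr)).flatten

/-- The relation `t₁ E_{(Φ,D)} t₂` iff `Φ ⊢_D ≡t₁t₂`. -/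
def Erel (D : Set Rule) (Φ : Set (Fm S ar)) (t₁ t₂ : Tm S ar) : Prop :=
  Derives D Φ (Fm.eq t₁ t₂)

/-- The Henkin interpretation `I_{(Φ,D)}`: the quotient of the term
interpretation `I_Φ` by the relation `E_{(Φ,D)}`. -/
noncomputable def henkin (D : Set Rule) (Φ : Set (Fm S ar)) : Interp S ar where
  A := Quot (Erel D Φ)
  ifun s f :=
    if h : 0 < ar s then Quot.mk _ (Tm.func s h (fun i => (f i).out))
    else if h0 : ar s = 0 then Quot.mk _ (Tm.const s h0)
    else Quot.mk _ (Tm.var 0)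
  irel s f := ∃ h : ar s < 0, Fm.rel s h (fun i => (f i).out) ∈ Φ
  asg n := Quot.mk _ (Tm.var n)

open Classical in
/-- The maximization sequence `Φ_j` of `Φ` along an enumeration `e` of the formulas. -/
noncomputable def maxSeq (D : Set Rule) (e : ℕ → Fm S ar) (Φ : Set (Fm S ar)) : ℕ → Set (Fm S ar)
  | 0 => Φ
  | n + 1 => maxSeq D e Φ n ∪
      {if Derives D (maxSeq D e Φ n) (e n).neg then (e n).neg else e n}

/-- `M⁺_D(Φ)`, the maximization of `Φ`. -/
noncomputable def Mplus (D : Set Rule) (e : ℕ → Fm S ar) (Φ : Set (Fm S ar)) : Set (Fm S ar) :=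
  ⋃ n, maxSeq D e Φ n

/-- A derivation of a sequent whose last (root) rule application is a rule of `D`
and all other rule applications use rules of `D₀`. -/
inductive DerTop (D₀ D : Set Rule) : Finset (Fm S ar) → Fm S ar → Prop where
  | ass : Rule.ass ∈ D → ∀ {Γ : Finset (Fm S ar)} {φ : Fm S ar}, φ ∈ Γ → DerTop D₀ D Γ φ
  | ant : Rule.ant ∈ D → ∀ {Γ Γ' : Finset (Fm S ar)} {φ : Fm S ar},
      Γ ⊆ Γ' → Der D₀ Γ φ → DerTop D₀ D Γ' φ
  | refl : Rule.refl ∈ D → ∀ t : Tm S ar, DerTop D₀ D ∅ (Fm.eq t t)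
  | subst : Rule.subst ∈ D → ∀ {Γ : Finset (Fm S ar)} (φ : Fm S ar) (x : ℕ) (t t' : Tm S ar),
      Der D₀ Γ (φ.substF x t) → DerTop D₀ D (insert (Fm.eq t t') Γ) (φ.substF x t')
  | exS : Rule.exS ∈ D → ∀ {Γ : Finset (Fm S ar)} (φ : Fm S ar) (x : ℕ) (t : Tm S ar),
      Der D₀ Γ (φ.substF x t) → DerTop D₀ D Γ (Fm.ex x φ)
  | exA : Rule.exA ∈ D → ∀ {Γ : Finset (Fm S ar)} (φ ψ : Fm S ar) (x x' : ℕ),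
      x' ∉ FreeSet ((↑Γ : Set (Fm S ar)) ∪ {Fm.ex x φ, ψ}) →
      Der D₀ (insert (φ.substF x (Tm.var x')) Γ) ψ → DerTop D₀ D (insert (Fm.ex x φ) Γ) ψ
  | norI : Rule.norI ∈ D → ∀ {Γ : Finset (Fm S ar)} {φ₁ φ₂ : Fm S ar},
      Der D₀ Γ (Fm.nor φ₁ φ₁) → Der D₀ Γ (Fm.nor φ₂ φ₂) → DerTop D₀ D Γ (Fm.nor φ₁ φ₂)
  | norS : Rule.norS ∈ D → ∀ {Γ : Finset (Fm S ar)} {φ₁ φ₂ : Fm S ar},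
      Der D₀ Γ (Fm.nor φ₁ φ₂) → DerTop D₀ D Γ (Fm.nor φ₂ φ₁)
  | ctrP : Rule.ctrP ∈ D → ∀ {Γ : Finset (Fm S ar)} {φ ψ : Fm S ar},
      Der D₀ (insert φ Γ) ψ → Der D₀ (insert φ Γ) ψ.neg → DerTop D₀ D Γ φ.neg
  | ctrN : Rule.ctrN ∈ D → ∀ {Γ : Finset (Fm S ar)} {φ ψ : Fm S ar},
      Der D₀ (insert φ.neg Γ) ψ → Der D₀ (insert φ.neg Γ) ψ.neg → DerTop D₀ D Γ φ

theorem Tm.varsT_finite (t : Tm S ar) : t.varsT.Finite := by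
  induction t with
  | var n => exact Set.finite_singleton n
  | const s h => exact Set.finite_empty
  | func s h ts ih => exact Set.finite_iUnion ih

theorem Tm.substT_eq_self {t : Tm S ar} {x : ℕ} (u : Tm S ar) (hx : x ∉ t.varsT) :
    t.substT x u = t := by
  induction t with
  | var n =>
    have hn : n ≠ x := fun h => hx (by simp [Tm.varsT, h])
    simp [Tm.substT, hn]
  | const s h => rfl
  | func s h ts ih =>
    simp only [Tm.varsT, Set.mem_iUnion, not_exists] at hx
    simp only [Tm.substT, fun i => ih i (hx i)]

theorem Tm.substT_update {n : ℕ} {ts : Fin n → Tm S ar} {x : ℕ} (i : Fin n) (u : Tm S ar)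
    (hx : x ∉ ⋃ j, (ts j).varsT) :
    (fun j => (Function.update ts i (Tm.var x) j).substT x u) = Function.update ts i u := by
  simp only [Set.mem_iUnion, not_exists] at hx
  funext j
  rcases eq_or_ne j i with rfl | hj
  · simp [Tm.substT]
  · simp [Function.update_of_ne hj, Tm.substT_eq_self u (hx j)]

/-- A property of tuples that is preserved by replacing single entries by related ones is
preserved by replacing all entries by related ones. -/
theorem of_forall_update {n : ℕ} {α : Type*} {R : α → α → Prop} {Q : (Fin n → α) → Prop}
    (hQ : ∀ us i b, R (us i) b → Q us → Q (Function.update us i b))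
    {us vs : Fin n → α} (huv : ∀ i, R (us i) (vs i)) (h : Q us) : Q vs := by
  have key : ∀ s : Finset (Fin n), Q (s.piecewise vs us) := by
    intro s
    induction s using Finset.induction_on with
    | empty => simpa using h
    | insert j s hj ih =>
      rw [Finset.piecewise_insert]
      refine hQ _ _ _ ?_ ih
      rw [Finset.piecewise_eq_of_notMem _ _ _ hj]
      exact huv j
  simpa using key Finset.univ

section Expanded

variable {D : Set Rule} {Φ : Set (Fm S ar)}

theorem Expanded.derives_iff (hexp : Expanded D Φ) (hass : Rule.ass ∈ D) {φ : Fm S ar} :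
    Derives D Φ φ ↔ φ ∈ Φ :=
  ⟨hexp φ, fun h => ⟨{φ}, by simpa using h, Der.ass hass (by simp)⟩⟩

theorem Expanded.eq_refl_mem (hexp : Expanded D Φ) (hrefl : Rule.refl ∈ D) (t : Tm S ar) :
    Fm.eq t t ∈ Φ :=
  hexp _ ⟨∅, by simp, Der.refl hrefl t⟩

theorem Expanded.substF_mem (hexp : Expanded D Φ) (hass : Rule.ass ∈ D) (hsubst : Rule.subst ∈ D)
    {t t' : Tm S ar} (ht : Fm.eq t t' ∈ Φ) (φ : Fm S ar) (x : ℕ) (h : φ.substF x t ∈ Φ) :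
    φ.substF x t' ∈ Φ :=
  hexp _ ⟨insert (Fm.eq t t') {φ.substF x t}, by simp [Set.insert_subset_iff, ht, h],
    Der.subst hsubst φ x t t' (Der.ass hass (by simp))⟩

theorem Expanded.eq_symm_mem (hexp : Expanded D Φ) (hass : Rule.ass ∈ D) (hrefl : Rule.refl ∈ D)
    (hsubst : Rule.subst ∈ D) {a b : Tm S ar} (hab : Fm.eq a b ∈ Φ) : Fm.eq b a ∈ Φ := by
  obtain ⟨x, hx⟩ := a.varsT_finite.exists_notMem
  have := hexp.substF_mem hass hsubst hab (Fm.eq (Tm.var x) a) x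
  simp only [Fm.substF, Tm.substT_eq_self _ hx, Tm.substT, if_true] at this
  exact this (hexp.eq_refl_mem hrefl a)

theorem Expanded.eq_trans_mem (hexp : Expanded D Φ) (hass : Rule.ass ∈ D)
    (hsubst : Rule.subst ∈ D) {a b c : Tm S ar} (hab : Fm.eq a b ∈ Φ) (hbc : Fm.eq b c ∈ Φ) :
    Fm.eq a c ∈ Φ := by
  obtain ⟨x, hx⟩ := a.varsT_finite.exists_notMem
  have := hexp.substF_mem hass hsubst hbc (Fm.eq a (Tm.var x)) x
  simp only [Fm.substF, Tm.substT_eq_self _ hx, Tm.substT, if_true] at this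
  exact this hab

theorem Expanded.rel_congr_mem (hexp : Expanded D Φ) (hass : Rule.ass ∈ D)
    (hsubst : Rule.subst ∈ D) {s : S} (hs : ar s < 0) {us vs : Fin (-ar s).toNat → Tm S ar}
    (huv : ∀ i, Fm.eq (us i) (vs i) ∈ Φ) (h : Fm.rel s hs us ∈ Φ) : Fm.rel s hs vs ∈ Φ := by
  refine of_forall_update (R := fun a b => Fm.eq a b ∈ Φ) (Q := fun ts => Fm.rel s hs ts ∈ Φ)
    (fun ts i b hb hts => ?_) huv h
  obtain ⟨x, hx⟩ := (Set.finite_iUnion fun i => (ts i).varsT_finite).exists_notMem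
  have := hexp.substF_mem hass hsubst hb (Fm.rel s hs (Function.update ts i (Tm.var x))) x
  simp only [Fm.substF, Tm.substT_update i _ hx, Function.update_eq_self] at this
  exact this hts

theorem Expanded.func_congr_mem (hexp : Expanded D Φ) (hass : Rule.ass ∈ D)
    (hrefl : Rule.refl ∈ D) (hsubst : Rule.subst ∈ D) {s : S} (hs : 0 < ar s)
    {us vs : Fin (ar s).toNat → Tm S ar} (huv : ∀ i, Fm.eq (us i) (vs i) ∈ Φ) :
    Fm.eq (Tm.func s hs us) (Tm.func s hs vs) ∈ Φ := by
  refine of_forall_update (R := fun a b => Fm.eq a b ∈ Φ)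
    (Q := fun ts => Fm.eq (Tm.func s hs us) (Tm.func s hs ts) ∈ Φ)
    (fun ts i b hb hts => ?_) huv (hexp.eq_refl_mem hrefl _)
  obtain ⟨x, hx⟩ := ((Tm.func s hs us).varsT_finite.union
    (Set.finite_iUnion fun i => (ts i).varsT_finite)).exists_notMem
  obtain ⟨hxu, hxt⟩ := not_or.mp hx
  have := hexp.substF_mem hass hsubst hb
    (Fm.eq (Tm.func s hs us) (Tm.func s hs (Function.update ts i (Tm.var x)))) x
  rw [Fm.substF, Fm.substF, Tm.substT_eq_self _ hxu, Tm.substT_eq_self _ hxu, Tm.substT,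
    Tm.substT, Tm.substT_update i _ hxt, Tm.substT_update i _ hxt,
    Function.update_eq_self] at this
  exact this hts

theorem Expanded.erel_equivalence (hexp : Expanded D Φ) (hass : Rule.ass ∈ D)
    (hrefl : Rule.refl ∈ D) (hsubst : Rule.subst ∈ D) : Equivalence (Erel D Φ) where
  refl t := (hexp.derives_iff hass).2 (hexp.eq_refl_mem hrefl t)
  symm h := (hexp.derives_iff hass).2 (hexp.eq_symm_mem hass hrefl hsubst (hexp _ h))
  trans h h' := (hexp.derives_iff hass).2 (hexp.eq_trans_mem hass hsubst (hexp _ h) (hexp _ h'))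

theorem Expanded.mk_eq_mk_iff (hexp : Expanded D Φ) (hass : Rule.ass ∈ D) (hrefl : Rule.refl ∈ D)
    (hsubst : Rule.subst ∈ D) {a b : Tm S ar} :
    Quot.mk (Erel D Φ) a = Quot.mk (Erel D Φ) b ↔ Fm.eq a b ∈ Φ := by
  rw [Quot.eq, (hexp.erel_equivalence hass hrefl hsubst).eqvGen_iff]
  exact hexp.derives_iff hass

theorem Expanded.eq_out_mem (hexp : Expanded D Φ) (hass : Rule.ass ∈ D) (hrefl : Rule.refl ∈ D)
    (hsubst : Rule.subst ∈ D) (t : Tm S ar) : Fm.eq (Quot.mk (Erel D Φ) t).out t ∈ Φ :=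
  (hexp.mk_eq_mk_iff hass hrefl hsubst).1 (Quot.out_eq _)

theorem Expanded.evalT_henkin (hexp : Expanded D Φ) (hass : Rule.ass ∈ D) (hrefl : Rule.refl ∈ D)
    (hsubst : Rule.subst ∈ D) (t : Tm S ar) :
    (henkin D Φ).evalT t = Quot.mk (Erel D Φ) t := by
  induction t with
  | var n => rfl
  | const s h => simp [Interp.evalT, henkin, h]
  | func s h ts ih =>
    simp only [Interp.evalT, ih]
    simp only [henkin, h, dif_pos]
    exact (hexp.mk_eq_mk_iff hass hrefl hsubst).2
      (hexp.func_congr_mem hass hrefl hsubst h fun i => hexp.eq_out_mem hass hrefl hsubst (ts i))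

end Expanded

/-- For `D` including Assumption, Antecedent, Reflexivity and Substitution, and
`Φ` `D`-expanded, the Henkin interpretation satisfies an atomic formula iff it
belongs to `Φ`. -/
theorem stmt12 {S : Type} [Countable S] {ar : S → ℤ} (D : Set Rule)
    (hass : Rule.ass ∈ D) (hant : Rule.ant ∈ D)
    (hrefl : Rule.refl ∈ D) (hsubst : Rule.subst ∈ D)
    (Φ : Set (Fm S ar)) (hexp : Expanded D Φ)
    (φ : Fm S ar) (hat : φ.Atomic) :
    (henkin D Φ).Sat φ ↔ φ ∈ Φ := by
  cases φ with
  | eq a b =>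
    rw [Interp.Sat, hexp.evalT_henkin hass hrefl hsubst, hexp.evalT_henkin hass hrefl hsubst]
    exact hexp.mk_eq_mk_iff hass hrefl hsubst
  | rel s h ts =>
    simp only [Interp.Sat, hexp.evalT_henkin hass hrefl hsubst]
    have hout := fun i => hexp.eq_out_mem hass hrefl hsubst (ts i)
    constructor
    · rintro ⟨_, hm⟩
      exact hexp.rel_congr_mem hass hsubst h hout hm
    · exact fun hm => ⟨h, hexp.rel_congr_mem hass hsubst h
        (fun i => hexp.eq_symm_mem hass hrefl hsubst (hout i)) hm⟩
  | nor φ ψ => exact hat.elim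
  | ex x φ => exact hat.elim
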